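/- Let S⃗ = (S_1,…,S_d) be a vector homogeneous tree, W a homogeneous tree with branching number b_W, 0 < ε ≤ 1, D : ⊗S⃗ → 2^W an ε-dense level selection, and for every s⃗ ∈ ⊗S⃗ let φ_{s⃗} : D(s⃗) → {0,…,b_W−1} be a map. Then there exist a vector strong subtree Z⃗ of S⃗ and p_0 ∈ {0,…,b_W−1} such that for every z⃗ ∈ ⊗Z⃗, dens({w ∈ D(z⃗) : φ_{z⃗}(w) = p_0}) ≥ ε/b_W. -/

import Mathlib

open Filter

namespace DHLPaper

/-- The tree `b^{<ℕ}` of all finite sequences with values in `{0,…,b−1}`,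
partially ordered by end-extension (`List.IsPrefix`, written `<+:`). -/
def bSeq (b : ℕ) : Set (List ℕ) := {t | ∀ x ∈ t, x < b}

/-- The set of successors of `t` in `T`: `Suc_T(t) = {s ∈ T : t ≤ s}`. -/
def suc (T : Set (List ℕ)) (t : List ℕ) : Set (List ℕ) := {s ∈ T | t <+: s}

/-- `s` is an immediate successor of `t` in `T`. -/
def ImmSuc (T : Set (List ℕ)) (t s : List ℕ) : Prop :=
  t ∈ T ∧ s ∈ T ∧ t <+: s ∧ t ≠ s ∧ ∀ u ∈ T, t <+: u → u <+: s → u = t ∨ u = s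

/-- The `n`-th level of `T`: the nodes of `T` with exactly `n` strict predecessors in `T`. -/
def level (T : Set (List ℕ)) (n : ℕ) : Set (List ℕ) :=
  {t ∈ T | {s ∈ T | s <+: t ∧ s ≠ t}.ncard = n}

/-- `T` has exactly one minimal node. -/
def UniquelyRooted (T : Set (List ℕ)) : Prop := ∃! r, r ∈ level T 0

/-- Every node of `T` has finitely many immediate successors in `T`. -/
def FinitelyBranching (T : Set (List ℕ)) : Prop := ∀ t ∈ T, {s | ImmSuc T t s}.Finite

/-- Every node of `T` has at least one immediate successor in `T`. -/
def Pruned (T : Set (List ℕ)) : Prop := ∀ t ∈ T, ∃ s, ImmSuc T t s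

/-- `S` is a strong subtree of `T` whose level set `L_T(S)` is enumerated by the strictly
increasing map `l`: `S(n) ⊆ T(l n)` for every `n`, `S` is uniquely rooted, and for every
`s ∈ S` and every immediate successor `t` of `s` in `T` there is a unique immediate
successor `s'` of `s` in `S` with `t ≤ s'`. -/
def IsStrongSubtreeWith (T S : Set (List ℕ)) (l : ℕ → ℕ) : Prop :=
  S ⊆ T ∧ UniquelyRooted S ∧ StrictMono l ∧
    (∀ n, level S n ⊆ level T (l n)) ∧
    (∀ s ∈ S, ∀ t, ImmSuc T s t → ∃! s', ImmSuc S s s' ∧ t <+: s')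

/-- `S` is a strong subtree of `T`. -/
def IsStrongSubtree (T S : Set (List ℕ)) : Prop := ∃ l, IsStrongSubtreeWith T S l

/-- A homogeneous tree with branching number `b`: a strong subtree of `b^{<ℕ}`, `b ≥ 2`. -/
def IsHomogeneous (b : ℕ) (T : Set (List ℕ)) : Prop := 2 ≤ b ∧ IsStrongSubtree (bSeq b) T

/-- A vector homogeneous tree: a `d`-tuple of homogeneous trees. -/
def IsVecHomogeneous {d : ℕ} (b : Fin d → ℕ) (T : Fin d → Set (List ℕ)) : Prop :=
  ∀ i, IsHomogeneous (b i) (T i)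

/-- Vector strong subtree: componentwise strong subtrees with a common level set. -/
def IsVecStrongSubtree {d : ℕ} (T S : Fin d → Set (List ℕ)) : Prop :=
  ∃ l, ∀ i, IsStrongSubtreeWith (T i) (S i) l

/-- `⊗T(n) = T_1(n) × ⋯ × T_d(n)`. -/
def vecLevel {d : ℕ} (T : Fin d → Set (List ℕ)) (n : ℕ) : Set (Fin d → List ℕ) :=
  {v | ∀ i, v i ∈ level (T i) n}

/-- The level product `⊗T = ⋃_n ⊗T(n)`. -/
def levelProd {d : ℕ} (T : Fin d → Set (List ℕ)) : Set (Fin d → List ℕ) :=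
  ⋃ n, vecLevel T n

/-- `r` is the root tuple of the vector tree `T`. -/
def IsRoot {d : ℕ} (T : Fin d → Set (List ℕ)) (r : Fin d → List ℕ) : Prop :=
  ∀ i, level (T i) 0 = {r i}

/-- `F` is a vector fan of `T`: `F = (R_1(0) ∪ R_1(1), …, R_d(0) ∪ R_d(1))` for some
vector strong subtree `R` of `T`. -/
def IsVecFan {d : ℕ} (T F : Fin d → Set (List ℕ)) : Prop :=
  ∃ R : Fin d → Set (List ℕ), IsVecStrongSubtree T R ∧
    ∀ i, F i = level (R i) 0 ∪ level (R i) 1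

/-- `fan(T,n)`: the vector fans of `T` with `⊗F(1) ⊆ ⊗T(n)`. -/
def fanAt {d : ℕ} (T : Fin d → Set (List ℕ)) (n : ℕ) : Set (Fin d → Set (List ℕ)) :=
  {F | IsVecFan T F ∧ vecLevel F 1 ⊆ vecLevel T n}

/-- Density of `F ⊆ W(n)` in the `n`-th level of `W`. -/
noncomputable def dens (W : Set (List ℕ)) (n : ℕ) (F : Set (List ℕ)) : ℝ :=
  (F.ncard : ℝ) / ((level W n).ncard : ℝ)

/-- Density of `F ⊆ W(n)` relative to the node `w`. -/
noncomputable def densRel (W : Set (List ℕ)) (n : ℕ) (F : Set (List ℕ)) (w : List ℕ) : ℝ :=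
  ((F ∩ suc W w).ncard : ℝ) / ((level W n ∩ suc W w).ncard : ℝ)

/-- `s = w ⌢_W p`: `s` is the immediate successor of `w` in `W` such that the
concatenation `w ⌢ p` is an initial segment of `s`. -/
def IsConcat (W : Set (List ℕ)) (w : List ℕ) (p : ℕ) (s : List ℕ) : Prop :=
  ImmSuc W w s ∧ w ++ [p] <+: s

/-- The density Halpern–Läuchli statement in dimension `d`. -/
def DHL (d : ℕ) : Prop :=
  ∀ (b : Fin d → ℕ) (T : Fin d → Set (List ℕ)), IsVecHomogeneous b T →
    ∀ D : Set (Fin d → List ℕ), D ⊆ levelProd T →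
      0 < Filter.limsup
          (fun n => ((D ∩ vecLevel T n).ncard : ℝ) / ((vecLevel T n).ncard : ℝ)) atTop →
      ∃ S : Fin d → Set (List ℕ), IsVecStrongSubtree T S ∧ levelProd S ⊆ D

/-- `D : ⊗T → 2^W` is an `ε`-dense level selection along the strictly increasing
sequence `l`: for every `n` and every `t⃗ ∈ ⊗T(n)`, `D(t⃗) ⊆ W(l n)` and
`dens(D(t⃗)) ≥ ε`. -/
def IsDenseLevelSel {d : ℕ} (T : Fin d → Set (List ℕ)) (W : Set (List ℕ)) (l : ℕ → ℕ)
    (ε : ℝ) (D : (Fin d → List ℕ) → Set (List ℕ)) : Prop :=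
  StrictMono l ∧ ∀ n, ∀ v ∈ vecLevel T n, D v ⊆ level W (l n) ∧ ε ≤ dens W (l n) (D v)

/-- The pair `(R, w)` (`R` a vector strong subtree of `T` with root tuple `r0`) is strongly
`θ`-correlated with respect to the dense level selection `D` (with level sequence `l`):
`w ∈ D(r0)` and for every vector fan `F` of `R` with `F(0) = r0` and every `p < b_W`,
`dens(⋂_{r ∈ ⊗F(1)} D(r) | w ⌢_W p) ≥ θ`. -/
def StronglyCorrelated {d : ℕ} (T : Fin d → Set (List ℕ)) (W : Set (List ℕ)) (bW : ℕ)
    (l : ℕ → ℕ) (D : (Fin d → List ℕ) → Set (List ℕ)) (R : Fin d → Set (List ℕ))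
    (r0 : Fin d → List ℕ) (w : List ℕ) (θ : ℝ) : Prop :=
  w ∈ D r0 ∧
    ∀ F : Fin d → Set (List ℕ), IsVecFan R F → IsRoot F r0 →
      ∀ n, vecLevel F 1 ⊆ vecLevel T n →
        ∀ p < bW, ∀ s, IsConcat W w p s →
          θ ≤ densRel W (l n) (⋂ r ∈ vecLevel F 1, D r) s

section CarlsonSimpson

attribute [local instance] Ultrafilter.semigroup

/-- Pushing ultrafilters forward along a homomorphism is multiplicative. -/
theorem ultrafilter_map_mul {G K : Type*} [Semigroup G] [Semigroup K] (f : G →ₙ* K)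
    (U V : Ultrafilter G) : (U * V).map f = U.map f * V.map f := by
  refine Ultrafilter.coe_inj.mp (Filter.ext' fun p => ?_)
  simp only [Ultrafilter.coe_map, Filter.eventually_map, Ultrafilter.eventually_mul, map_mul]

/-- A nonempty compact Hausdorff semigroup with continuous right translations contains a nonempty
closed left ideal on which every idempotent of the ideal acts as a right identity. -/
theorem exists_closed_left_ideal_right_identity {M : Type*} [Nonempty M] [Semigroup M]
    [TopologicalSpace M] [CompactSpace M] [T2Space M]
    (hcont : ∀ r : M, Continuous (· * r)) :
    ∃ I : Set M, IsClosed I ∧ I.Nonempty ∧ (∀ m, ∀ x ∈ I, m * x ∈ I) ∧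
      ∀ x ∈ I, ∀ e ∈ I, e * e = e → x * e = x := by
  let 𝓘 : Set (Set M) := {N | IsClosed N ∧ N.Nonempty ∧ ∀ m, ∀ x ∈ N, m * x ∈ N}
  obtain ⟨I, hI⟩ : ∃ I, Minimal (· ∈ 𝓘) I := by
    refine zorn_superset _ fun c hcs hc => ?_
    refine ⟨⋂₀ c, ⟨isClosed_sInter fun t ht => (hcs ht).1, ?_, fun m x hx => ?_⟩, fun s hs =>
      Set.sInter_subset_of_mem hs⟩
    · obtain rfl | hne := c.eq_empty_or_nonempty
      · rw [Set.sInter_empty]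
        exact Set.univ_nonempty
      have := hne.coe_sort
      rw [Set.sInter_eq_iInter]
      exact IsCompact.nonempty_iInter_of_directed_nonempty_isCompact_isClosed
        ((↑) : c → Set M) (DirectedOn.directed_val (IsChain.directedOn hc.symm))
        (fun i => (hcs i.prop).2.1) (fun i => (hcs i.prop).1.isCompact) (fun i => (hcs i.prop).1)
    · exact Set.mem_sInter.mpr fun t ht => (hcs ht).2.2 m x (Set.mem_sInter.mp hx t ht)
  obtain ⟨hclosed, hne, hmul⟩ := hI.prop
  refine ⟨I, hclosed, hne, hmul, fun x hx e he hee => ?_⟩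
  have hrange : Set.range (· * e) = I := by
    refine hI.eq_of_subset ⟨(isCompact_range (hcont e)).isClosed, ⟨e * e, e, rfl⟩, ?_⟩ ?_
    · rintro m _ ⟨y, rfl⟩
      exact ⟨m * y, mul_assoc _ _ _⟩
    · rintro _ ⟨y, rfl⟩
      exact hmul y e he
  rw [← hrange] at hx
  obtain ⟨y, rfl⟩ := hx
  simp only [mul_assoc, hee]

/-- Let `e a : G → K` be homomorphisms with a common section `ι`, and let `L` be a nonempty right
ideal of `G`. Then some ultrafilter on `L` has images under the `e a` that form a left zero
band. -/
theorem exists_ultrafilter_left_zero {G K A : Type*} [Semigroup G] [Semigroup K] [Nonempty K]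
    (e : A → G →ₙ* K) (ι : K →ₙ* G) (hι : ∀ a k, e a (ι k) = k)
    (L : Set G) (hL : L.Nonempty) (hLmul : ∀ x ∈ L, ∀ y, x * y ∈ L) :
    ∃ U : Ultrafilter G, L ∈ U ∧ ∀ a a', U.map (e a) * U.map (e a') = U.map (e a) := by
  obtain ⟨I, hIclosed, ⟨u, hu⟩, hImul, hIright⟩ :=
    exists_closed_left_ideal_right_identity (M := Ultrafilter K) Ultrafilter.continuous_mul_left
  obtain ⟨y, hy⟩ := hL
  let s : Set (Ultrafilter G) := {U | L ∈ U} ∩ ⋂ a, (fun U => U.map (e a)) ⁻¹' I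
  have hcont : ∀ a, Continuous (fun U : Ultrafilter G => U.map (e a)) := fun a =>
    ultrafilterBasis_is_basis.continuous_iff.2 <| Set.forall_mem_range.mpr fun t =>
      ultrafilter_isOpen_basic (e a ⁻¹' t)
  have hs : IsClosed s :=
    (ultrafilter_isClosed_basic L).inter
      (isClosed_iInter fun a => hIclosed.preimage (hcont a))
  have hLU : ∀ U V : Ultrafilter G, L ∈ U → L ∈ U * V := fun U V hU => by
    change ∀ᶠ m in ((U * V : Ultrafilter G) : Filter G), m ∈ L
    rw [Ultrafilter.eventually_mul]
    filter_upwards [hU] with x hx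
    exact Filter.Eventually.of_forall (hLmul x hx)
  have hsne : s.Nonempty := by
    refine ⟨pure y * u.map ι, hLU _ _ hy, Set.mem_iInter.mpr fun a => ?_⟩
    have hid : e a ∘ ι = id := funext (hι a)
    rw [Set.mem_preimage, ultrafilter_map_mul, Ultrafilter.map_map, hid, Ultrafilter.map_id]
    exact hImul _ _ hu
  obtain ⟨U, ⟨hU, hUI⟩, hidem⟩ := exists_idempotent_in_compact_subsemigroup
    Ultrafilter.continuous_mul_left s hsne hs.isCompact fun U hU V hV => by
      refine ⟨hLU U V hU.1, Set.mem_iInter.mpr fun a => ?_⟩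
      rw [Set.mem_preimage, ultrafilter_map_mul]
      exact hImul _ _ (Set.mem_iInter.mp hV.2 a)
  refine ⟨U, hU, fun a a' => hIright _ (Set.mem_iInter.mp hUI a) _ (Set.mem_iInter.mp hUI a') ?_⟩
  rw [← ultrafilter_map_mul, hidem]

/-- The value of the variable word with letters `x` at the letter `p`. -/
def substVar {A : Type*} (p : A) (x : List (Option A)) : List A := x.map (·.getD p)

/-- The word `w ⌢ x₀(a₀) ⌢ ⋯ ⌢ xₙ₋₁(aₙ₋₁)`, where the `k`-th left variable word consists of the
variable followed by `x k`. -/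
def substWord {A : Type*} (w : List A) (x : ℕ → List (Option A)) (a : List A) : List A :=
  w ++ (a.mapIdx fun n p => p :: substVar p (x n)).flatten

theorem substWord_concat {A : Type*} (w : List A) (x : ℕ → List (Option A)) (a : List A) (p : A) :
    substWord w x (a ++ [p]) = substWord w x a ++ p :: substVar p (x a.length) := by
  simp [substWord]

/-- For every finite coloring of the words over `A` there is a nonempty monochromatic set `E` of
words such that finitely many elements of `E` are always extended within `E` by all values of a
common left variable word. -/
theorem exists_absorbing_extension {A : Type*} [Finite A] [Nonempty A] {κ : Type*} [Finite κ]
    (c : List A → κ) :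
    ∃ k, ∃ E : Set (List A), E.Nonempty ∧ (∀ w ∈ E, c w = k) ∧
      ∀ F ⊆ E, F.Finite → ∃ x : List (Option A), ∀ w ∈ F, ∀ p, w ++ p :: substVar p x ∈ E := by
  let e : A → FreeMonoid (Option A) →ₙ* FreeMonoid A := fun a =>
    (FreeMonoid.map fun o : Option A => o.getD a : FreeMonoid (Option A) →* FreeMonoid A)
  let ι : FreeMonoid A →ₙ* FreeMonoid (Option A) :=
    (FreeMonoid.map some : FreeMonoid A →* FreeMonoid (Option A))
  have hι : ∀ a k, e a (ι k) = k := fun a k => by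
    have h : ∀ k : List A, (k.map some).map (·.getD a) = k := by simp
    exact h k
  let L : Set (FreeMonoid (Option A)) :=
    Set.range fun x => FreeMonoid.of none * x
  obtain ⟨U, hU, habs⟩ := exists_ultrafilter_left_zero e ι hι L ⟨_, 1, rfl⟩ (by
    rintro _ ⟨x, rfl⟩ y
    exact ⟨x * y, (mul_assoc _ _ _).symm⟩)
  have key : ∀ (a : A) (P : FreeMonoid A → Prop), (∀ᶠ x in U, P (e a x)) →
      ∀ᶠ x in U, ∀ a', ∀ᶠ y in U, P (e a x * e a' y) := fun a P hP => by
    rw [Filter.eventually_all]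
    intro a'
    have h : ∀ᶠ x in ((U.map (e a) : Ultrafilter _) : Filter _), P x := hP
    rw [← habs a a', Ultrafilter.eventually_mul] at h
    exact h
  obtain ⟨a₀⟩ := ‹Nonempty A›
  let c : FreeMonoid A → κ := c
  obtain ⟨k, hk⟩ : ∃ k, ∀ᶠ x in U, c (e a₀ x) = k := by
    have h : ∀ᶠ x in U, ∃ k ∈ (Set.univ : Set κ), c (e a₀ x) = k :=
      Filter.Eventually.of_forall fun x => ⟨_, trivial, rfl⟩
    obtain ⟨k, -, hk⟩ := (Ultrafilter.eventually_exists_mem_iff Set.finite_univ).mp h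
    exact ⟨k, hk⟩
  let E : Set (FreeMonoid A) := {w | c w = k ∧ ∀ a, ∀ᶠ x in U, c (w * e a x) = k}
  refine ⟨k, E, ?_, fun w hw => hw.1, fun (F : Set (FreeMonoid A)) hF hfin => ?_⟩
  · obtain ⟨x, hx, hx'⟩ := (hk.and (key a₀ (c · = k) hk)).exists
    exact ⟨e a₀ x, hx, hx'⟩
  · have h : ∀ᶠ x in U, ∀ w : FreeMonoid A, w ∈ F → ∀ p, w * e p x ∈ E := by
      refine (Filter.eventually_all_finite hfin).mpr fun (w : FreeMonoid A) hw => ?_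
      rw [Filter.eventually_all]
      intro p
      filter_upwards [(hF hw).2 p, key p (fun v => c (w * v) = k) ((hF hw).2 p)] with x hx hx'
      exact ⟨hx, fun a => by simpa only [mul_assoc] using hx' a⟩
    obtain ⟨_, hx, x, rfl⟩ := (h.and hU).exists
    exact ⟨x, hx⟩

/-- The Carlson–Simpson theorem for left variable words. -/
theorem carlson_simpson {A : Type*} [Finite A] [Nonempty A] {κ : Type*} [Finite κ]
    (c : List A → κ) :
    ∃ k w x, ∀ a, c (substWord w x a) = k := by
  obtain ⟨k, E, ⟨w, hw⟩, hE, hext⟩ := exists_absorbing_extension c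
  choose! g hg using hext
  let F : ℕ → Set (List A) := fun n => Nat.rec {w}
    (fun _ s => Set.image2 (fun v p => v ++ p :: substVar p (g s)) s Set.univ) n
  have hF : ∀ n, F n ⊆ E ∧ (F n).Finite := by
    intro n
    induction n with
    | zero => exact ⟨Set.singleton_subset_iff.mpr hw, Set.finite_singleton w⟩
    | succ n ih =>
      refine ⟨?_, ih.2.image2 _ Set.finite_univ⟩
      rintro _ ⟨v, hv, p, -, rfl⟩
      exact hg _ ih.1 ih.2 v hv p
  refine ⟨k, w, fun n => g (F n), fun a => hE _ ((hF a.length).1 ?_)⟩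
  induction a using List.reverseRecOn with
  | nil => simp [substWord, F]
  | append_singleton a p ih =>
    rw [substWord_concat, List.length_append]
    exact ⟨_, ih, p, trivial, rfl⟩

end CarlsonSimpson

section TreeParametrization

/-- `h` maps sequences to sequences so that the letter `p` appended to `s` is recorded, through
`j`, directly after `h s` in `h (s ⌢ p)`. -/
def IsBranching {β γ : Type*} (j : β → γ) (h : List β → List γ) : Prop :=
  ∀ s p, h s ++ [j p] <+: h (s ++ [p])

theorem IsBranching.prefix_of_prefix {β γ : Type*} {j : β → γ} {h : List β → List γ}
    (hh : IsBranching j h) {s t : List β} (hst : s <+: t) : h s <+: h t := by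
  obtain ⟨u, rfl⟩ := hst
  induction u using List.reverseRecOn with
  | nil => simp
  | append_singleton u p ih =>
    rw [← List.append_assoc]
    exact ih.trans ((List.prefix_append _ _).trans (hh _ p))

theorem IsBranching.comp {β γ δ : Type*} {j : β → γ} {j' : γ → δ} {h : List β → List γ}
    {h' : List γ → List δ} (hh' : IsBranching j' h') (hh : IsBranching j h) :
    IsBranching (j' ∘ j) (h' ∘ h) := fun s p =>
  (hh' (h s) (j p)).trans (hh'.prefix_of_prefix (hh s p))

theorem concat_prefix_unique {γ : Type*} {s t : List γ} {p p' : γ} (h : s ++ [p] <+: t)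
    (h' : s ++ [p'] <+: t) : p = p' := by
  have := (List.prefix_of_prefix_length_le h h' (by simp)).eq_of_length (by simp)
  simpa using this

theorem IsBranching.prefix_iff {β γ : Type*} {j : β → γ} {h : List β → List γ}
    (hh : IsBranching j h) (hj : Function.Injective j) {s t : List β} :
    h s <+: h t ↔ s <+: t := by
  refine ⟨fun hst => ?_, hh.prefix_of_prefix⟩
  induction s using List.reverseRecOn with
  | nil => exact List.nil_prefix
  | append_singleton s p ih =>
    obtain ⟨u, rfl⟩ := ih ((hh.prefix_of_prefix (List.prefix_append _ _)).trans hst)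
    have hp := (hh s p).trans hst
    cases u with
    | nil =>
      have := hp.length_le
      simp at this
    | cons p' u =>
      have hp' : h s ++ [j p'] <+: h (s ++ p' :: u) :=
        (hh s p').trans (hh.prefix_of_prefix ⟨u, by simp⟩)
      rw [hj (concat_prefix_unique hp hp')]
      exact ⟨u, by simp⟩

theorem IsBranching.injective {β γ : Type*} {j : β → γ} {h : List β → List γ}
    (hh : IsBranching j h) (hj : Function.Injective j) : Function.Injective h := fun s t hst => by
  have h₁ := (hh.prefix_iff hj).mp (hst ▸ List.prefix_rfl : h s <+: h t)
  have h₂ := (hh.prefix_iff hj).mp (hst ▸ List.prefix_rfl : h t <+: h s)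
  exact h₁.eq_of_length (le_antisymm h₁.length_le h₂.length_le)

variable {β : Type*} {j : β → ℕ} {h : List β → List ℕ}

theorem IsBranching.mem_level_iff (hh : IsBranching j h) (hj : Function.Injective j) {n : ℕ}
    {t : List ℕ} : t ∈ level (Set.range h) n ↔ ∃ s, s.length = n ∧ h s = t := by
  have hcard : ∀ s, {u ∈ Set.range h | u <+: h s ∧ u ≠ h s}.ncard = s.length := fun s => by
    have heq : {u ∈ Set.range h | u <+: h s ∧ u ≠ h s} =
        (fun k => h (s.take k)) '' Set.Iio s.length := by
      ext u
      constructor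
      · rintro ⟨⟨v, rfl⟩, hv, hne⟩
        rw [hh.prefix_iff hj] at hv
        refine ⟨v.length, lt_of_le_of_ne hv.length_le fun hl => hne ?_, ?_⟩
        · rw [hv.eq_of_length hl]
        · simp only [← List.prefix_iff_eq_take.mp hv]
      · rintro ⟨k, hk, rfl⟩
        refine ⟨⟨_, rfl⟩, hh.prefix_of_prefix (List.take_prefix _ _), fun heq => ?_⟩
        have := congrArg List.length (hh.injective hj heq)
        simp only [List.length_take, Set.mem_Iio] at this hk
        omega
    have hinj : Set.InjOn (fun k => h (s.take k)) (Set.Iio s.length) := fun k hk k' hk' hkk => by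
      have := congrArg List.length (hh.injective hj hkk)
      simp only [List.length_take, Set.mem_Iio] at this hk hk'
      omega
    rw [heq, hinj.ncard_image, ← Finset.coe_Iio, Set.ncard_coe_finset, Nat.card_Iio]
  constructor
  · rintro ⟨⟨s, rfl⟩, hn⟩
    exact ⟨s, (hcard s).symm.trans hn, rfl⟩
  · rintro ⟨s, rfl, rfl⟩
    exact ⟨⟨s, rfl⟩, hcard s⟩

theorem IsBranching.immSuc_iff (hh : IsBranching j h) (hj : Function.Injective j) {s : List β}
    {t : List ℕ} : ImmSuc (Set.range h) (h s) t ↔ ∃ p, t = h (s ++ [p]) := by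
  constructor
  · rintro ⟨-, ⟨u, rfl⟩, hsu, hne, hmin⟩
    obtain ⟨v, rfl⟩ := (hh.prefix_iff hj).mp hsu
    cases v with
    | nil => simp at hne
    | cons p v =>
      refine ⟨p, ?_⟩
      rcases hmin (h (s ++ [p])) ⟨_, rfl⟩ (hh.prefix_of_prefix (List.prefix_append _ _))
        (hh.prefix_of_prefix ⟨v, by simp⟩) with heq | heq
      · have := hh.injective hj heq
        simp at this
      · exact heq.symm
  · rintro ⟨p, rfl⟩
    refine ⟨⟨_, rfl⟩, ⟨_, rfl⟩, hh.prefix_of_prefix (List.prefix_append _ _), fun heq => ?_, ?_⟩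
    · have := hh.injective hj heq
      simp at this
    · rintro _ ⟨u, rfl⟩ hsu hus
      rw [hh.prefix_iff hj] at hsu hus
      obtain ⟨v, rfl⟩ := hsu
      have hlen := hus.length_le
      simp only [List.length_append, List.length_singleton] at hlen
      rcases Nat.eq_zero_or_pos v.length with hv | hv
      · rw [List.length_eq_zero_iff.mp hv]
        simp
      · refine Or.inr (congrArg h (hus.eq_of_length ?_))
        simp only [List.length_append, List.length_singleton]
        omega

/-- Composing a parametrization of a tree with a level-uniform branching map yields a strong
subtree. -/
theorem IsBranching.isStrongSubtreeWith (hh : IsBranching j h) (hj : Function.Injective j)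
    {q : List β → List β} (hq : IsBranching id q) {l : ℕ → ℕ} (hl : StrictMono l)
    (hlen : ∀ s, (q s).length = l s.length) :
    IsStrongSubtreeWith (Set.range h) (Set.range (h ∘ q)) l := by
  have hg : IsBranching j (h ∘ q) := hh.comp hq
  refine ⟨Set.range_comp_subset_range q h, ⟨(h ∘ q) [], ?_, ?_⟩, hl, ?_, ?_⟩
  · exact (hg.mem_level_iff hj).mpr ⟨[], rfl, rfl⟩
  · intro t ht
    obtain ⟨s, hs, rfl⟩ := (hg.mem_level_iff hj).mp ht
    rw [List.length_eq_zero_iff.mp hs]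
  · intro n t ht
    obtain ⟨s, rfl, rfl⟩ := (hg.mem_level_iff hj).mp ht
    exact (hh.mem_level_iff hj).mpr ⟨q s, hlen s, rfl⟩
  · rintro _ ⟨s, rfl⟩ t ht
    obtain ⟨p, rfl⟩ := (hh.immSuc_iff hj).mp ht
    refine ⟨(h ∘ q) (s ++ [p]),
      ⟨(hg.immSuc_iff hj).mpr ⟨p, rfl⟩, hh.prefix_of_prefix (hq s p)⟩, ?_⟩
    rintro _ ⟨ht', hpre⟩
    obtain ⟨p', rfl⟩ := (hg.immSuc_iff hj).mp ht'
    rw [Function.comp_apply, hh.prefix_iff hj] at hpre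
    rw [concat_prefix_unique hpre (hq s p'), id]

theorem immSuc_bSeq {b : ℕ} {t : List ℕ} (ht : t ∈ bSeq b) {p : ℕ} (hp : p < b) :
    ImmSuc (bSeq b) t (t ++ [p]) := by
  refine ⟨ht, ?_, List.prefix_append _ _, by simp, ?_⟩
  · intro x hx
    rcases List.mem_append.mp hx with hx | hx
    · exact ht x hx
    · rw [List.mem_singleton.mp hx]
      exact hp
  · rintro _ - ⟨v, rfl⟩ hv
    have hlen := hv.length_le
    simp only [List.length_append, List.length_singleton] at hlen
    rcases Nat.eq_zero_or_pos v.length with hv0 | hv0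
    · rw [List.length_eq_zero_iff.mp hv0]
      simp
    · refine Or.inr (hv.eq_of_length ?_)
      simp only [List.length_append, List.length_singleton]
      omega

/-- Strictly above `s` and below `t` there is an immediate successor of `s`. -/
theorem exists_immSuc_prefix {T : Set (List ℕ)} {s t : List ℕ} (hs : s ∈ T) (ht : t ∈ T)
    (hst : s <+: t) (hne : s ≠ t) : ∃ u, ImmSuc T s u ∧ u <+: t := by
  let X : Set (List ℕ) := {u ∈ T | s <+: u ∧ s ≠ u ∧ u <+: t}
  have hX : X.Nonempty := ⟨t, ht, hst, hne, List.prefix_rfl⟩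
  obtain ⟨u, ⟨huT, hsu, hsne, hut⟩, hmin⟩ :=
    (measure List.length).wf.has_min X hX
  refine ⟨u, ⟨hs, huT, hsu, hsne, fun v hv hsv hvu => ?_⟩, hut⟩
  by_contra! hcon
  refine hmin v ⟨hv, hsv, hcon.1.symm, hvu.trans hut⟩ ?_
  exact lt_of_le_of_ne hvu.length_le fun hl => hcon.2 (hvu.eq_of_length hl)

/-- Every node of a tree lies above a minimal node. -/
theorem exists_mem_level_zero_prefix {T : Set (List ℕ)} {t : List ℕ} (ht : t ∈ T) :
    ∃ r ∈ level T 0, r <+: t := by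
  obtain ⟨r, ⟨hrT, hrt⟩, hmin⟩ :=
    (measure List.length).wf.has_min {u ∈ T | u <+: t} ⟨t, ht, List.prefix_rfl⟩
  refine ⟨r, ⟨hrT, ?_⟩, hrt⟩
  have hempty : {s ∈ T | s <+: r ∧ s ≠ r} = ∅ := by
    refine Set.eq_empty_of_forall_notMem ?_
    rintro s ⟨hs, hsr, hne⟩
    refine hmin s ⟨hs, hsr.trans hrt⟩ ?_
    exact lt_of_le_of_ne hsr.length_le fun hl => hne (hsr.eq_of_length hl)
  rw [hempty, Set.ncard_empty]

/-- A homogeneous tree with branching number `b` is parametrized by the finite sequences with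
values in `{0,…,b−1}`. -/
theorem IsHomogeneous.exists_isBranching {b : ℕ} {T : Set (List ℕ)} (hT : IsHomogeneous b T) :
    ∃ f : List (Fin b) → List ℕ, IsBranching Fin.val f ∧ Set.range f = T := by
  obtain ⟨-, -, hTb, ⟨r, hr, hroot_unique⟩, -, -, hsuc⟩ := hT
  have hnext : ∀ t ∈ T, ∀ p : Fin b, ∃! s, ImmSuc T t s ∧ t ++ [p.val] <+: s := fun t ht p =>
    hsuc t ht _ (immSuc_bSeq (hTb ht) p.isLt)
  have hex := fun t ht p => (hnext t ht p).exists
  choose! next himm hpre using hex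
  let f : List (Fin b) → List ℕ := fun s => s.foldl next r
  have hf : ∀ s p, f (s ++ [p]) = next (f s) p := fun s p => by simp [f]
  have hfT : ∀ s, f s ∈ T := fun s => by
    induction s using List.reverseRecOn with
    | nil => exact hr.1
    | append_singleton s p ih =>
      rw [hf]
      exact (himm _ ih p).2.1
  refine ⟨f, fun s p => hf s p ▸ hpre _ (hfT s) p, Set.Subset.antisymm ?_ fun t ht => ?_⟩
  · rintro _ ⟨s, rfl⟩
    exact hfT s
  have hroot : f [] <+: t := by
    obtain ⟨v, hv0, hvt⟩ := exists_mem_level_zero_prefix ht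
    rwa [hroot_unique v hv0] at hvt
  obtain ⟨s, hst, hmax⟩ : ∃ s, f s <+: t ∧ ∀ p, ¬ f (s ++ [p]) <+: t := by
    by_contra! hcon
    have hlong : ∀ n, ∃ s, f s <+: t ∧ n ≤ (f s).length := fun n => by
      induction n with
      | zero => exact ⟨[], hroot, Nat.zero_le _⟩
      | succ n ih =>
        obtain ⟨s, hst, hn⟩ := ih
        obtain ⟨p, hp⟩ := hcon s hst
        refine ⟨s ++ [p], hp, ?_⟩
        have := (hpre _ (hfT s) p).length_le
        rw [← hf, List.length_append, List.length_singleton] at this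
        omega
    obtain ⟨s, hst, hn⟩ := hlong (t.length + 1)
    have := hst.length_le
    omega
  refine ⟨s, by_contra fun hne => ?_⟩
  obtain ⟨u, hu, hut⟩ := exists_immSuc_prefix (hfT s) ht hst hne
  obtain ⟨v, hv⟩ := hu.2.2.1
  cases v with
  | nil => exact hu.2.2.2.1 (by simpa using hv)
  | cons x v =>
    have hx : x < b := hTb hu.2.1 x (by simp [← hv])
    refine hmax ⟨x, hx⟩ ?_
    rw [hf, (hnext _ (hfT s) ⟨x, hx⟩).unique ⟨himm _ (hfT s) _, hpre _ (hfT s) _⟩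
      ⟨hu, ⟨v, by simpa using hv⟩⟩]
    exact hut

end TreeParametrization

section HalpernLauchli

theorem isBranching_substWord {A : Type*} (w : List A) (x : ℕ → List (Option A)) :
    IsBranching id (substWord w x) := fun s p =>
  ⟨substVar p (x s.length), by simp [substWord_concat]⟩

theorem length_substWord {A : Type*} (w : List A) (x : ℕ → List (Option A)) (a : List A) :
    (substWord w x a).length =
      w.length + ∑ k ∈ Finset.range a.length, ((x k).length + 1) := by
  induction a using List.reverseRecOn with
  | nil => simp [substWord]
  | append_singleton a p ih =>
    simp [substWord_concat, ih, Finset.sum_range_succ, substVar, add_assoc]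

theorem map_substVar {A B : Type*} (f : A → B) (p : A) (x : List (Option A)) :
    (substVar p x).map f = substVar (f p) (x.map (Option.map f)) := by
  simp only [substVar, List.map_map]
  refine List.map_congr_left fun o _ => ?_
  cases o <;> rfl

theorem map_substWord {A B : Type*} (f : A → B) (w : List A) (x : ℕ → List (Option A))
    (a : List A) :
    (substWord w x a).map f =
      substWord (w.map f) (fun n => (x n).map (Option.map f)) (a.map f) := by
  induction a using List.reverseRecOn with
  | nil => simp [substWord]
  | append_singleton a p ih =>
    rw [substWord_concat, List.map_append, ih, List.map_cons, map_substVar, List.map_append,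
      List.map_singleton, substWord_concat, List.length_map]

/-- The Halpern–Läuchli theorem for vector homogeneous trees. -/
theorem halpern_lauchli {d : ℕ} {b : Fin d → ℕ} {S : Fin d → Set (List ℕ)}
    (hS : IsVecHomogeneous b S) {κ : Type*} [Finite κ] (c : (Fin d → List ℕ) → κ) :
    ∃ Z : Fin d → Set (List ℕ), IsVecStrongSubtree S Z ∧ ∃ k, ∀ z ∈ levelProd Z, c z = k := by
  choose f hf hfS using fun i => (hS i).exists_isBranching
  have : ∀ i, NeZero (b i) := fun i => ⟨by have := (hS i).1; omega⟩
  obtain ⟨k, w, x, hk⟩ := carlson_simpson (A := ∀ i, Fin (b i))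
    fun u => c fun i => f i (u.map (· i))
  let q : ∀ i, List (Fin (b i)) → List (Fin (b i)) := fun i =>
    substWord (w.map (· i)) fun n => (x n).map (Option.map (· i))
  have hq : ∀ i, IsBranching id (q i) := fun i => isBranching_substWord _ _
  let l : ℕ → ℕ := fun n => w.length + ∑ m ∈ Finset.range n, ((x m).length + 1)
  have hl : StrictMono l := strictMono_nat_of_lt_succ fun n => by
    simp only [l, Finset.sum_range_succ]
    omega
  refine ⟨fun i => Set.range (f i ∘ q i), ⟨l, fun i => ?_⟩, k, fun z hz => ?_⟩
  · rw [← hfS i]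
    exact (hf i).isStrongSubtreeWith Fin.val_injective (hq i) hl fun s => by
      simp [q, l, length_substWord]
  · obtain ⟨n, hn⟩ := Set.mem_iUnion.mp hz
    choose σ hσ hσz using fun i =>
      (((hf i).comp (hq i)).mem_level_iff Fin.val_injective).mp (hn i)
    let a : List (∀ i, Fin (b i)) :=
      List.ofFn fun m : Fin n => fun i => (σ i).get (m.cast (hσ i).symm)
    have ha : ∀ i, a.map (· i) = σ i := fun i => by
      refine List.ext_getElem (by simp [a, hσ]) fun m h₁ h₂ => ?_
      simp [a]
    rw [← hk a]
    congr 1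
    funext i
    rw [map_substWord, ha, ← hσz i]
    rfl

end HalpernLauchli

/-- Some fiber of a map into `{0,…,k−1}` has at least the average density. -/
theorem exists_dens_fiber_ge {W F : Set (List ℕ)} {n k : ℕ} {ε : ℝ} (hk : 0 < k) (hε : 0 < ε)
    (hF : ε ≤ dens W n F) {φ : List ℕ → ℕ} (hφ : ∀ w ∈ F, φ w < k) :
    ∃ p : Fin k, ε / k ≤ dens W n {w ∈ F | φ w = p} := by
  have hk' : (0 : ℝ) < k := Nat.cast_pos.mpr hk
  by_contra! hcon
  have hfin : F.Finite := Set.finite_of_ncard_ne_zero fun h0 => by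
    simp only [dens, h0, Nat.cast_zero, zero_div] at hF
    linarith
  have hcover : F = ⋃ p : Fin k, {w ∈ F | φ w = p} := by
    ext w
    simp only [Set.mem_iUnion, Set.mem_sep_iff]
    exact ⟨fun hw => ⟨⟨φ w, hφ w hw⟩, hw, rfl⟩, fun ⟨_, hw, _⟩ => hw⟩
  have hcard : F.ncard ≤ ∑ p : Fin k, {w ∈ F | φ w = p}.ncard := by
    conv_lhs => rw [hcover]
    exact Set.ncard_iUnion_le_of_fintype _
  have hsum : dens W n F ≤ ∑ p : Fin k, dens W n {w ∈ F | φ w = p} := by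
    simp only [dens, ← Finset.sum_div, ← Nat.cast_sum]
    gcongr
  have hlt : ∑ p : Fin k, dens W n {w ∈ F | φ w = p} < ∑ _p : Fin k, ε / k :=
    Finset.sum_lt_sum_of_nonempty ⟨⟨0, hk⟩, Finset.mem_univ _⟩ fun p _ => hcon p
  rw [Finset.sum_const, Finset.card_univ, Fintype.card_fin, nsmul_eq_mul,
    mul_div_cancel₀ _ hk'.ne'] at hlt
  linarith

/-- Lemma 4.9: fixing the direction `p₀`. -/
theorem fixing_the_direction (d : ℕ) (b : Fin d → ℕ) (S : Fin d → Set (List ℕ))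
    (hS : IsVecHomogeneous b S)
    (bW : ℕ) (W : Set (List ℕ)) (hW : IsHomogeneous bW W)
    (ε : ℝ) (hε0 : 0 < ε) (hε1 : ε ≤ 1)
    (l : ℕ → ℕ) (D : (Fin d → List ℕ) → Set (List ℕ)) (hD : IsDenseLevelSel S W l ε D)
    (φ : (Fin d → List ℕ) → List ℕ → ℕ)
    (hφ : ∀ s ∈ levelProd S, ∀ w ∈ D s, φ s w < bW) :
    ∃ Z : Fin d → Set (List ℕ), IsVecStrongSubtree S Z ∧
      ∃ p0 < bW, ∀ z ∈ levelProd Z, ∀ n, z ∈ vecLevel S n →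
        ε / (bW : ℝ) ≤ dens W (l n) {w ∈ D z | φ z w = p0} := by
  obtain ⟨hl, hD⟩ := hD
  have hbW : 0 < bW := lt_of_lt_of_le two_pos hW.1
  have hlevel : ∀ z m n, z ∈ vecLevel S m → z ∈ vecLevel S n → m = n := fun z m n hm hn => by
    have hne : (D z).Nonempty := Set.nonempty_of_ncard_ne_zero fun h0 => by
      have := (hD m z hm).2
      simp only [dens, h0, Nat.cast_zero, zero_div] at this
      linarith
    obtain ⟨w, hw⟩ := hne
    exact hl.injective (((hD m z hm).1 hw).2.symm.trans ((hD n z hn).1 hw).2)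
  have hcolor : ∀ z, ∃ p : Fin bW, ∀ n, z ∈ vecLevel S n →
      ε / bW ≤ dens W (l n) {w ∈ D z | φ z w = p} := fun z => by
    by_cases hz : ∃ m, z ∈ vecLevel S m
    · obtain ⟨m, hm⟩ := hz
      obtain ⟨p, hp⟩ := exists_dens_fiber_ge hbW hε0 (hD m z hm).2
        (hφ z (Set.mem_iUnion.mpr ⟨m, hm⟩))
      exact ⟨p, fun n hn => hlevel z m n hm hn ▸ hp⟩
    · exact ⟨⟨0, hbW⟩, fun n hn => (hz ⟨n, hn⟩).elim⟩
  choose c hc using hcolor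
  obtain ⟨Z, hZ, p, hp⟩ := halpern_lauchli hS c
  exact ⟨Z, hZ, p, p.isLt, fun z hz n hn => hp z hz ▸ hc z n hn⟩

end DHLPaper
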